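/- Let n > 0 and let S ⊆ ℕ^ℕ be a subset of Baire space. If S is Σ⁰ₙ (respectively Π⁰ₙ), then there is a Σₙ (respectively Πₙ) sentence φ of L_Bor that defines S, i.e., for every f : ℕ → ℕ, f ∈ S if and only if M_f ⊨ φ. -/

import Mathlib

/-- The index data of the symbols `ℓ_ι`, `τ_ι` of `L_Bor`: a function
`ι : ℕⁿ → ℕ^{<ℕ} ∖ {⟨⟩}` (with `n > 0`). -/
def BIota (n : ℕ) : Type := (Fin n → ℕ) → {l : List ℕ // l ≠ []}

/-- Terms of the extended variadic language `L_Bor`: numeral constant symbols `𝐧`,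
variables (indexed by `ℕ`), the unary function symbol `𝐟`, the `n`-ary function symbols
`ℓ_ι`, and the `n`-ary-by-variadic function symbols `τ_ι`, the latter forming terms
`τ_ι(u₁,…,uₙ,u(𝟎)⋯ₓu(v))`. -/
inductive BTerm : Type
  | const : ℕ → BTerm
  | var : ℕ → BTerm
  | fapp : BTerm → BTerm
  | len : {n : ℕ} → BIota (n + 1) → (Fin (n + 1) → BTerm) → BTerm
  | tau : {n : ℕ} → BIota (n + 1) → (Fin (n + 1) → BTerm) → BTerm → ℕ → BTerm → BTerm

namespace BTerm

/-- The free variables of an `L_Bor` term. -/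
def fv : BTerm → Set ℕ
  | const _ => ∅
  | var x => {x}
  | fapp u => u.fv
  | len _ ts => ⋃ i, (ts i).fv
  | tau _ ts u x v => (⋃ i, (ts i).fv) ∪ (u.fv \ {x}) ∪ v.fv

/-- Substitution of a term for a variable in an `L_Bor` term. -/
def subst : BTerm → ℕ → BTerm → BTerm
  | const c, _, _ => const c
  | var y, x, t => if y = x then t else var y
  | fapp u, x, t => fapp (u.subst x t)
  | len ι ts, x, t => len ι fun i => (ts i).subst x t
  | tau ι ts u y v, x, t =>
      if y = x then tau ι (fun i => (ts i).subst x t) u y (v.subst x t)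
      else tau ι (fun i => (ts i).subst x t) (u.subst x t) y (v.subst x t)

/-- The depth of an `L_Bor` term. -/
def depth : BTerm → ℕ
  | const _ => 0
  | var _ => 0
  | fapp u => u.depth + 1
  | len _ ts => (Finset.univ.sup fun i => (ts i).depth) + 1
  | tau _ ts u _ v =>
      max ((Finset.univ.sup fun i => (ts i).depth)) (max u.depth v.depth) + 1

lemma depth_subst_const (x : ℕ) (c : ℕ) :
    ∀ u : BTerm, (u.subst x (const c)).depth = u.depth
  | const _ => rfl
  | var y => by by_cases h : y = x <;> simp [subst, h, depth]
  | fapp u => by simp [subst, depth, depth_subst_const x c u]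
  | len ι ts => by
      simp only [subst, depth]
      congr 1
      exact Finset.sup_congr rfl fun i _ => depth_subst_const x c (ts i)
  | tau ι ts u y v => by
      by_cases h : y = x <;>
        simp only [subst, h, depth, if_true, if_false, depth_subst_const x c u,
          depth_subst_const x c v] <;>
      · congr 2
        exact Finset.sup_congr rfl fun i _ => depth_subst_const x c (ts i)

/-- The interpretation of an `L_Bor` term in the structure `M_f`, by an assignment `s`,
by recursion on term depth. -/
def interp (f : ℕ → ℕ) : BTerm → (ℕ → ℕ) → ℕ
  | const c, _ => c
  | var x, s => s x
  | fapp u, s => f (u.interp f s)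
  | len ι ts, s => (ι fun i => (ts i).interp f s).1.length - 1
  | tau ι ts u x v, s =>
      if ((List.range (v.interp f s + 1)).map fun k => (u.subst x (const k)).interp f s) =
          (ι fun i => (ts i).interp f s).1 then 1 else 0
termination_by t _ => t.depth
decreasing_by
  all_goals first
    | exact Nat.lt_succ_of_le (Nat.le_refl _)
    | exact Nat.lt_succ_of_le (Finset.le_sup (f := fun i => (ts i).depth) (Finset.mem_univ i))
    | exact Nat.lt_succ_of_le (le_trans (Finset.le_sup (f := fun i => (ts i).depth)
        (Finset.mem_univ i)) (le_max_left _ _))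
    | exact Nat.lt_succ_of_le (le_trans (le_max_right _ _) (le_max_right _ _))
    | (rw [BTerm.depth_subst_const];
       exact Nat.lt_succ_of_le (le_trans (le_max_left _ _) (le_max_right _ _)))

end BTerm

/-- Formulas of `L_Bor`. -/
inductive BFormula : Type
  | eq : BTerm → BTerm → BFormula
  | not : BFormula → BFormula
  | and : BFormula → BFormula → BFormula
  | or : BFormula → BFormula → BFormula
  | imp : BFormula → BFormula → BFormula
  | iff : BFormula → BFormula → BFormula
  | all : ℕ → BFormula → BFormula
  | ex : ℕ → BFormula → BFormula

namespace BFormula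

/-- The free variables of an `L_Bor` formula. -/
def fv : BFormula → Set ℕ
  | eq u v => u.fv ∪ v.fv
  | not φ => φ.fv
  | and φ ψ => φ.fv ∪ ψ.fv
  | or φ ψ => φ.fv ∪ ψ.fv
  | imp φ ψ => φ.fv ∪ ψ.fv
  | iff φ ψ => φ.fv ∪ ψ.fv
  | all y φ => φ.fv \ {y}
  | ex y φ => φ.fv \ {y}

/-- Quantifier-free `L_Bor` formulas. -/
inductive QF : BFormula → Prop
  | eq (u v : BTerm) : QF (.eq u v)
  | not {φ} : QF φ → QF (.not φ)
  | and {φ ψ} : QF φ → QF ψ → QF (.and φ ψ)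
  | or {φ ψ} : QF φ → QF ψ → QF (.or φ ψ)
  | imp {φ ψ} : QF φ → QF ψ → QF (.imp φ ψ)
  | iff {φ ψ} : QF φ → QF ψ → QF (.iff φ ψ)

end BFormula

/-- Satisfaction `M_f ⊨ φ[s]` of an `L_Bor` formula by an assignment. -/
def BSatisfies (f : ℕ → ℕ) (s : ℕ → ℕ) : BFormula → Prop
  | .eq u v => u.interp f s = v.interp f s
  | .not φ => ¬ BSatisfies f s φ
  | .and φ ψ => BSatisfies f s φ ∧ BSatisfies f s ψ
  | .or φ ψ => BSatisfies f s φ ∨ BSatisfies f s ψ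
  | .imp φ ψ => BSatisfies f s φ → BSatisfies f s ψ
  | .iff φ ψ => (BSatisfies f s φ ↔ BSatisfies f s ψ)
  | .all x φ => ∀ n : ℕ, BSatisfies f (Function.update s x n) φ
  | .ex x φ => ∃ n : ℕ, BSatisfies f (Function.update s x n) φ

/-- `M_f ⊨ φ`: satisfaction by every assignment. -/
def BModels (f : ℕ → ℕ) (φ : BFormula) : Prop := ∀ s : ℕ → ℕ, BSatisfies f s φ

mutual
/-- `Σₙ` prenex formulas of `L_Bor`: `n` alternating blocks of quantifiers beginning
with existentials, followed by a quantifier-free formula (blocks may be empty). -/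
inductive SigmaFml : ℕ → BFormula → Prop
  | ofQF {φ} : BFormula.QF φ → SigmaFml 0 φ
  | ofPi {n φ} : PiFml n φ → SigmaFml (n + 1) φ
  | ex {n} (x : ℕ) {φ} : SigmaFml (n + 1) φ → SigmaFml (n + 1) (.ex x φ)

/-- `Πₙ` prenex formulas of `L_Bor`: `n` alternating blocks of quantifiers beginning
with universals, followed by a quantifier-free formula (blocks may be empty). -/
inductive PiFml : ℕ → BFormula → Prop
  | ofQF {φ} : BFormula.QF φ → PiFml 0 φ
  | ofSigma {n φ} : SigmaFml n φ → PiFml (n + 1) φ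
  | all {n} (x : ℕ) {φ} : PiFml (n + 1) φ → PiFml (n + 1) (.all x φ)
end

/-- The finite Borel hierarchy on Baire space: `Σ⁰₁` sets are the open sets, and
`Σ⁰ₙ₊₁` sets are countable unions of `Π⁰ₙ` sets, where a set is `Π⁰ₙ` iff its
complement is `Σ⁰ₙ`. -/
def SigmaPt : ℕ → Set (ℕ → ℕ) → Prop
  | 0, _ => False
  | 1, S => IsOpen S
  | (n + 2), S =>
      ∃ A : ℕ → Set (ℕ → ℕ), (∀ i, SigmaPt (n + 1) (A i)ᶜ) ∧ S = ⋃ i, A i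

/-- A set is `Π⁰ₙ` iff its complement is `Σ⁰ₙ`. -/
def PiPt (n : ℕ) (S : Set (ℕ → ℕ)) : Prop := SigmaPt n Sᶜ

/-- A point is in an open set iff a nonempty initial segment of it forces membership. -/
lemma exists_prefix_subset_of_isOpen {U : Set (ℕ → ℕ)} (hU : IsOpen U) (f : ℕ → ℕ) :
    f ∈ U ↔ ∃ l : {l : List ℕ // l ≠ []}, (List.range l.1.length).map f = l.1 ∧
      ∀ g : ℕ → ℕ, (List.range l.1.length).map g = l.1 → g ∈ U := by
  refine ⟨fun hf => ?_, fun ⟨l, hl, h⟩ => h f hl⟩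
  obtain ⟨V, ⟨x, m, rfl⟩, hfV, hVU⟩ :=
    (PiNat.isTopologicalBasis_cylinders fun _ : ℕ => ℕ).isOpen_iff.1 hU f hf
  refine ⟨⟨(List.range (m + 1)).map f, by simp⟩, by simp, fun g hg => hVU fun i hi => ?_⟩
  simp only [List.length_map, List.length_range, List.map_inj_left, List.mem_range] at hg
  rw [hg i (by lia), hfV i hi]

/-- The first `k + 1` variables, as a tuple of terms. -/
def firstVars (k : ℕ) : Fin (k + 1) → BTerm := fun i => .var i

/-- The formula expressing that the sequence coded by `ι` at the first `k + 1` variables has the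
length of the one coded by `κ` and is an initial segment of `𝐟`. -/
def prefixFml {k : ℕ} (ι κ : BIota (k + 1)) : BFormula :=
  .eq (.tau ι (firstVars k) (.fapp (.var (k + 1))) (k + 1) (.len κ (firstVars k))) (.const 1)

lemma fv_prefixFml {k : ℕ} (ι κ : BIota (k + 1)) : (prefixFml ι κ).fv ⊆ Set.Iio (k + 1) := by
  intro x
  simp only [prefixFml, firstVars, BFormula.fv, BTerm.fv, sdiff_self, Set.bot_eq_empty,
    Set.union_empty, Set.union_self, Set.mem_iUnion, Set.mem_singleton_iff, Set.mem_Iio]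
  rintro ⟨i, rfl⟩
  exact i.2

lemma satisfies_prefixFml {k : ℕ} (ι κ : BIota (k + 1)) (f s : ℕ → ℕ) :
    BSatisfies f s (prefixFml ι κ) ↔
      (List.range (κ fun i => s i).1.length).map f = (ι fun i => s i).1 := by
  have h : (κ fun i => s i).1.length - 1 + 1 = (κ fun i => s i).1.length :=
    Nat.sub_add_cancel (List.length_pos_iff.2 (κ fun i => s i).2)
  simp [prefixFml, firstVars, BSatisfies, BTerm.interp, BTerm.subst, h]

lemma init_update {k : ℕ} (s : ℕ → ℕ) (m : ℕ) :
    (Fin.init fun i : Fin (k + 1) => Function.update s k m i) = fun i : Fin k => s i := by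
  funext i
  simp [Fin.init, Function.update_of_ne i.2.ne]

/-- A family of open sets is defined by an existential quantifier over a prefix formula. -/
lemma exists_prefixFml_of_isOpen {k : ℕ} (A : (Fin k → ℕ) → Set (ℕ → ℕ))
    (hA : ∀ a, IsOpen (A a)) :
    ∃ ι κ : BIota (k + 1), ∀ f s : ℕ → ℕ, f ∈ A (fun i => s i) ↔
      ∃ m, BSatisfies f (Function.update s k m) (prefixFml ι κ) := by
  classical
  have : Nonempty {l : List ℕ // l ≠ []} := ⟨⟨[0], by simp⟩⟩
  obtain ⟨e, he⟩ := exists_surjective_nat {l : List ℕ // l ≠ []}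
  refine ⟨fun b => e (b (Fin.last k)), fun b =>
    if ∀ g : ℕ → ℕ, (List.range (e (b (Fin.last k))).1.length).map g = (e (b (Fin.last k))).1 →
      g ∈ A (Fin.init b) then e (b (Fin.last k))
    else ⟨0 :: (e (b (Fin.last k))).1, by simp⟩, fun f s => ?_⟩
  rw [exists_prefix_subset_of_isOpen (hA _), he.exists]
  refine exists_congr fun m => ?_
  refine Iff.trans ?_ (satisfies_prefixFml _ _ _ _).symm
  simp only [Fin.val_last, Function.update_self, init_update]
  split_ifs with h
  · exact and_iff_left h
  · refine iff_of_false (fun h' => h h'.2) fun h' => ?_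
    simpa using congrArg List.length h'

lemma fv_diff_subset {k : ℕ} {F : Set ℕ} (h : F ⊆ Set.Iio (k + 1)) : F \ {k} ⊆ Set.Iio k := by
  rintro x ⟨hx, hxk⟩
  exact lt_of_le_of_ne (Nat.lt_succ_iff.1 (h hx)) hxk

/-- Families of `Σ⁰ₙ₊₁` (resp. `Π⁰ₙ₊₁`) sets indexed by `ℕᵏ` are defined by `Σₙ₊₁`
(resp. `Πₙ₊₁`) formulas whose first `k` variables carry the index. -/
lemma exists_fml_of_family (n : ℕ) : ∀ (k : ℕ) (A : (Fin k → ℕ) → Set (ℕ → ℕ)),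
    ((∀ a, SigmaPt (n + 1) (A a)) → ∃ φ, SigmaFml (n + 1) φ ∧ φ.fv ⊆ Set.Iio k ∧
      ∀ f s : ℕ → ℕ, f ∈ A (fun i => s i) ↔ BSatisfies f s φ) ∧
    ((∀ a, PiPt (n + 1) (A a)) → ∃ φ, PiFml (n + 1) φ ∧ φ.fv ⊆ Set.Iio k ∧
      ∀ f s : ℕ → ℕ, f ∈ A (fun i => s i) ↔ BSatisfies f s φ) := by
  induction n with
  | zero =>
    intro k A
    constructor
    · intro hA
      obtain ⟨ι, κ, h⟩ := exists_prefixFml_of_isOpen A hA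
      exact ⟨.ex k (prefixFml ι κ), .ex k (.ofPi (.ofQF (.eq _ _))),
        fv_diff_subset (fv_prefixFml ι κ), h⟩
    · intro hA
      obtain ⟨ι, κ, h⟩ := exists_prefixFml_of_isOpen (fun a => (A a)ᶜ) hA
      refine ⟨.all k (.not (prefixFml ι κ)), .all k (.ofSigma (.ofQF (.not (.eq _ _)))),
        fv_diff_subset (fv_prefixFml ι κ), fun f s => ?_⟩
      rw [← not_iff_not, ← Set.mem_compl_iff, h]
      simp [BSatisfies]
  | succ n ih =>
    intro k A
    constructor
    · intro hA
      choose B hB hAB using hA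
      obtain ⟨φ, hφ, hfv, h⟩ := (ih (k + 1) fun b => B (Fin.init b) (b (Fin.last k))).2
        fun b => hB _ _
      refine ⟨.ex k φ, .ex k (.ofPi hφ), fv_diff_subset hfv, fun f s => ?_⟩
      simp [BSatisfies, ← h, hAB, init_update]
    · intro hA
      choose B hB hAB using hA
      obtain ⟨φ, hφ, hfv, h⟩ := (ih (k + 1) fun b => (B (Fin.init b) (b (Fin.last k)))ᶜ).1
        fun b => hB _ _
      refine ⟨.all k φ, .all k (.ofSigma hφ), fv_diff_subset hfv, fun f s => ?_⟩
      rw [← not_iff_not, ← Set.mem_compl_iff, hAB]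
      simp [BSatisfies, ← h, init_update]

/-- If `S ⊆ ℕ^ℕ` is `Σ⁰ₙ` (resp. `Π⁰ₙ`) for `n > 0`, then `S` is defined by a `Σₙ`
(resp. `Πₙ`) sentence of `L_Bor`. -/
theorem borel_defined_by_sentence (n : ℕ) (hn : 0 < n) (S : Set (ℕ → ℕ)) :
    (SigmaPt n S → ∃ φ : BFormula, SigmaFml n φ ∧ φ.fv = ∅ ∧
        ∀ f : ℕ → ℕ, f ∈ S ↔ BModels f φ) ∧
    (PiPt n S → ∃ φ : BFormula, PiFml n φ ∧ φ.fv = ∅ ∧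
        ∀ f : ℕ → ℕ, f ∈ S ↔ BModels f φ) := by
  obtain ⟨n, rfl⟩ := Nat.exists_eq_succ_of_ne_zero hn.ne'
  have hmodels (φ : BFormula) (h : ∀ f s : ℕ → ℕ, f ∈ S ↔ BSatisfies f s φ) (f : ℕ → ℕ) :
      f ∈ S ↔ BModels f φ :=
    ⟨fun hf s => (h f s).1 hf, fun hf => (h f f).2 (hf f)⟩
  have hempty {F : Set ℕ} (h : F ⊆ Set.Iio 0) : F = ∅ :=
    Set.eq_empty_of_forall_notMem fun x hx => Nat.not_lt_zero x (h hx)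
  constructor
  · intro hS
    obtain ⟨φ, hφ, hfv, h⟩ := (exists_fml_of_family n 0 fun _ => S).1 fun _ => hS
    exact ⟨φ, hφ, hempty hfv, hmodels φ h⟩
  · intro hS
    obtain ⟨φ, hφ, hfv, h⟩ := (exists_fml_of_family n 0 fun _ => S).2 fun _ => hS
    exact ⟨φ, hφ, hempty hfv, hmodels φ h⟩
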